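/- Let (U; A_1, …, A_m) be an (n', m, ℓ, β) set-system with m·β < 1. Let ρ : U → {1,…,m} be any function satisfying u ∈ A_{ρ(u)} for every u ∈ U. Call an index i heavy if |ρ^{-1}(i)| ≥ β²·n'. Then the number of heavy indices is at least ℓ. -/

import Mathlib

open Finset
open scoped Classical

/-- `(U; A_1, …, A_m)` (with `U = Fin n'`) is an `(n', m, ℓ, β)` set-system if for every
index set `I ⊆ [m]` with `|I| ≤ ℓ` and every choice of sets `B i` for `i ∈ I`, each equal
to `A i` or its complement, the union `⋃_{i ∈ I} B i` has at most `(1 - β) n'` elements. -/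
def IsSetSystem (n' m ℓ : ℕ) (β : ℝ) (A : Fin m → Finset (Fin n')) : Prop :=
  ∀ I : Finset (Fin m), I.card ≤ ℓ →
    ∀ B : Fin m → Finset (Fin n'),
      (∀ i ∈ I, B i = A i ∨ B i = (A i)ᶜ) →
      ((I.biUnion B).card : ℝ) ≤ (1 - β) * n'

/-- let `(U; A_1, …, A_m)` be an `(n', m, ℓ, β)` set-system with `m·β < 1`
and let `ρ : U → [m]` satisfy `u ∈ A_{ρ(u)}` for all `u`.  Calling an index `i` heavy when
`|ρ⁻¹(i)| ≥ β²·n'`, the number of heavy indices is at least `ℓ`. -/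
theorem heavy_indices_lower_bound
    (n' m ℓ : ℕ) (hn' : 0 < n') (hm : 0 < m) (hℓ : 0 < ℓ)
    (β : ℝ) (hβ : 0 < β) (hβ1 : β < 1) (hmβ : (m : ℝ) * β < 1)
    (A : Fin m → Finset (Fin n')) (hA : IsSetSystem n' m ℓ β A)
    (ρ : Fin n' → Fin m) (hρ : ∀ u, u ∈ A (ρ u)) :
    ℓ ≤ (Finset.univ.filter (fun i : Fin m =>
        β ^ 2 * (n' : ℝ) ≤ ((Finset.univ.filter (fun u : Fin n' => ρ u = i)).card : ℝ))).card := by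
  by_contra! hlt
  set H := Finset.univ.filter (fun i : Fin m =>
    β ^ 2 * (n' : ℝ) ≤ ((Finset.univ.filter (fun u : Fin n' => ρ u = i)).card : ℝ)) with hH
  have hunion := hA H hlt.le A (fun _ _ => Or.inl rfl)
  have hcover : (Finset.univ : Finset (Fin n')) ⊆
      H.biUnion A ∪ Hᶜ.biUnion (fun i => Finset.univ.filter (fun u => ρ u = i)) := by
    intro u _
    by_cases h : ρ u ∈ H
    · exact mem_union_left _ (mem_biUnion.2 ⟨ρ u, h, hρ u⟩)
    · exact mem_union_right _ (mem_biUnion.2 ⟨ρ u, mem_compl.2 h, by simp⟩)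
  have hcard : (n' : ℝ) ≤ (H.biUnion A).card +
      ∑ i ∈ Hᶜ, ((Finset.univ.filter (fun u => ρ u = i)).card : ℝ) := by
    have h := (card_le_card hcover).trans ((card_union_le _ _).trans
      (Nat.add_le_add_left card_biUnion_le _))
    rw [card_univ, Fintype.card_fin] at h
    exact_mod_cast h
  have hlight : ∑ i ∈ Hᶜ, ((Finset.univ.filter (fun u => ρ u = i)).card : ℝ) ≤
      Hᶜ.card * (β ^ 2 * n') := by
    rw [← nsmul_eq_mul]
    refine sum_le_card_nsmul _ _ _ fun i hi => ?_
    simp only [hH, mem_compl, mem_filter, mem_univ, true_and, not_le] at hi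
    exact hi.le
  have hcompl : (Hᶜ.card : ℝ) ≤ m := by
    exact_mod_cast (card_le_univ Hᶜ).trans_eq (Fintype.card_fin m)
  have hn : (0 : ℝ) < n' := by exact_mod_cast hn'
  have hbound : (Hᶜ.card : ℝ) * (β ^ 2 * n') ≤ m * (β ^ 2 * n') := by gcongr
  have hstrict : (m : ℝ) * (β ^ 2 * n') < β * n' := by
    have h := mul_lt_mul_of_pos_right hmβ (mul_pos hβ hn)
    linarith
  linarith
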